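/- Adding a hub: let P be a simple closed curve with four marked points s, t, u, v in interleaved cyclic order (s, u, t, v). Suppose there exist a simple exterior arc joining s to t and a simple exterior arc joining u to v, disjoint from each other and meeting P only at endpoints. Then connecting an interior point w to s, t, u, v by four interior arcs that are pairwise disjoint except at w yields a plane embedding of a graph containing a subdivision of K₅ — contradiction; hence such exterior arcs cannot exist. -/

import Mathlib

/-- A simple closed curve in the plane: the image of a continuous injection of the circle. -/
def IsSimpleClosedCurve (P : Set (ℝ × ℝ)) : Prop :=
  ∃ f : AddCircle (1 : ℝ) → ℝ × ℝ, Continuous f ∧ Function.Injective f ∧ Set.range f = P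

/-- The interior of a simple closed curve: points of the complement whose connected
component in the complement is bounded. -/
def JordanInterior (P : Set (ℝ × ℝ)) : Set (ℝ × ℝ) :=
  {y | y ∉ P ∧ Bornology.IsBounded (connectedComponentIn Pᶜ y)}

/-- The exterior of a simple closed curve: points of the complement whose connected
component in the complement is unbounded. -/
def JordanExterior (P : Set (ℝ × ℝ)) : Set (ℝ × ℝ) :=
  {y | y ∉ P ∧ ¬ Bornology.IsBounded (connectedComponentIn Pᶜ y)}

/-- A simple arc in the plane from `a` to `b` with image `γ`. -/
def IsArc (γ : Set (ℝ × ℝ)) (a b : ℝ × ℝ) : Prop :=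
  ∃ f : ℝ → ℝ × ℝ, ContinuousOn f (Set.Icc 0 1) ∧ Set.InjOn f (Set.Icc 0 1) ∧
    f 0 = a ∧ f 1 = b ∧ γ = f '' Set.Icc 0 1

/-- Four distinct points `s, u, t, v` on a simple closed curve `P` are interleaved
(occur in this cyclic order) when `u` and `v` lie on different arcs of `P` determined
by `s` and `t`. -/
def Interleaved (P : Set (ℝ × ℝ)) (s u t v : ℝ × ℝ) : Prop :=
  s ∈ P ∧ u ∈ P ∧ t ∈ P ∧ v ∈ P ∧
    [s, u, t, v].Nodup ∧
    connectedComponentIn (P \ {s, t}) u ≠ connectedComponentIn (P \ {s, t}) v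

/-- `z` is the total change of `log (a t - p)` for `t` from `0` to `1`. -/
def IsChg (p : ℂ) (a : ℝ → ℂ) (z : ℂ) : Prop :=
  ∃ φ : ℝ → ℂ, Continuous φ ∧ (∀ t, Complex.exp (φ t) = a t - p) ∧ φ 1 - φ 0 = z

lemma const_of_exp_const (φ : ℝ → ℂ) (hφ : Continuous φ)
    (h : ∀ t, Complex.exp (φ t) = Complex.exp (φ 0)) (t : ℝ) : φ t = φ 0 := by
  have hcov := Complex.isCoveringMapOn_exp.existsUnique_continuousMap_lifts
    (A := ℝ) (ContinuousMap.const ℝ (Complex.exp (φ 0))) (a₀ := 0) (e₀ := φ 0) rfl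
    (fun _ => by simp)
  have h1 := hcov.unique (y₁ := ⟨φ, hφ⟩) (y₂ := ContinuousMap.const ℝ (φ 0))
    ⟨rfl, by ext t; simpa using h t⟩ ⟨rfl, by ext t; simp⟩
  exact congrArg (fun F : C(ℝ, ℂ) => F t) h1

lemma IsChg.unique {p : ℂ} {a : ℝ → ℂ} {z z' : ℂ} (h : IsChg p a z) (h' : IsChg p a z') :
    z = z' := by
  obtain ⟨φ, hc, he, rfl⟩ := h
  obtain ⟨ψ, hc', he', rfl⟩ := h'
  have hne : ∀ t, a t - p ≠ 0 := fun t => by rw [← he t]; exact Complex.exp_ne_zero _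
  have := const_of_exp_const (fun t => φ t - ψ t) (hc.sub hc') (fun t => by
    simp only [Complex.exp_sub, he, he', div_self (hne _)]) 1
  linear_combination this

lemma IsChg.int {p : ℂ} {a : ℝ → ℂ} {z A B : ℂ} (h : IsChg p a z)
    (hA : Complex.exp A = a 0 - p) (hB : Complex.exp B = a 1 - p) :
    ∃ n : ℤ, z = B - A + 2 * Real.pi * Complex.I * n := by
  obtain ⟨φ, hc, he, rfl⟩ := h
  have h0 := (he 0).trans hA.symm
  have h1 := (he 1).trans hB.symm
  obtain ⟨n, hn⟩ := Complex.exp_eq_exp_iff_exists_int.1 h0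
  obtain ⟨m, hm⟩ := Complex.exp_eq_exp_iff_exists_int.1 h1
  refine ⟨m - n, ?_⟩
  push_cast
  linear_combination hm - hn

lemma square_chg (a b : ℝ → ℂ) (ha : Continuous a) (hb : Continuous b)
    (hab : ∀ x y, a x ≠ b y) :
    ∃ z1 z2 z3 z4, IsChg (b 0) a z1 ∧ IsChg (b 1) a z2 ∧ IsChg (a 0) b z3 ∧ IsChg (a 1) b z4 ∧
      z1 + z4 = z2 + z3 := by
  obtain ⟨F, ⟨-, hF⟩, -⟩ := Complex.isCoveringMapOn_exp.existsUnique_continuousMap_lifts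
    (A := ℝ × ℝ) ⟨fun q => a q.1 - b q.2, by fun_prop⟩ (a₀ := (0, 0))
    (e₀ := Complex.log (a 0 - b 0)) (by
      simpa using Complex.exp_log (sub_ne_zero.2 (hab 0 0)))
    (fun q => by simpa using sub_ne_zero.2 (hab q.1 q.2))
  have hF' : ∀ x y, Complex.exp (F (x, y)) = a x - b y := fun x y => congrFun hF (x, y)
  refine ⟨_, _, _, _, ⟨fun t => F (t, 0), by fun_prop, fun t => hF' _ _, rfl⟩,
    ⟨fun t => F (t, 1), by fun_prop, fun t => hF' _ _, rfl⟩,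
    ⟨fun t => F (0, t) + Real.pi * Complex.I, by fun_prop, fun t => ?_, rfl⟩,
    ⟨fun t => F (1, t) + Real.pi * Complex.I, by fun_prop, fun t => ?_, rfl⟩, by ring⟩ <;>
  · rw [Complex.exp_add, hF', Complex.exp_pi_mul_I]; ring

lemma k5_core (p : Fin 5 → ℂ) (e : Fin 5 → Fin 5 → ℝ → ℂ)
    (hc : ∀ i j, i < j → Continuous (e i j)) (h0 : ∀ i j, i < j → e i j 0 = p i)
    (h1 : ∀ i j, i < j → e i j 1 = p j)
    (hd : ∀ i j k l, i < j → k < l → i < k → j ≠ k → j ≠ l → ∀ x y, e i j x ≠ e k l y) :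
    False := by
  classical
  set A : Fin 5 → Fin 5 → ℂ := fun a b => if a < b then Complex.log (p b - p a)
    else Complex.log (p a - p b) + Real.pi * Complex.I with hA
  set ε : Fin 5 → Fin 5 → ℤ := fun a b => if a < b then 1 else -1 with hε
  have hAexp : ∀ a b, p b ≠ p a → Complex.exp (A a b) = p b - p a := by
    intro a b hab
    simp only [hA]
    split_ifs
    · exact Complex.exp_log (sub_ne_zero.2 hab)
    · rw [Complex.exp_add, Complex.exp_log (sub_ne_zero.2 hab.symm), Complex.exp_pi_mul_I]; ring
  have hAε : ∀ a b, a ≠ b → A b a - A a b = Real.pi * Complex.I * ε a b := by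
    intro a b hab
    simp only [hA, hε]
    rcases lt_or_gt_of_ne hab with h | h
    · simp [h, not_lt.2 h.le]
    · simp [h, not_lt.2 h.le]
  let Q : Fin 5 → Fin 5 → Fin 5 → ℤ → Prop := fun k i j n =>
    IsChg (p k) (e i j) (A k j - A k i + 2 * Real.pi * Complex.I * n)
  let N : Fin 5 → Fin 5 → Fin 5 → ℤ := fun k i j => Classical.epsilon (Q k i j)
  have hN : ∀ k i j z, i < j → p i ≠ p k → p j ≠ p k → IsChg (p k) (e i j) z →
      z = A k j - A k i + 2 * Real.pi * Complex.I * N k i j := by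
    intro k i j z hij hik hjk hz
    obtain ⟨n, hn⟩ := hz.int (A := A k i) (B := A k j)
      (by rw [h0 i j hij]; exact hAexp _ _ hik) (by rw [h1 i j hij]; exact hAexp _ _ hjk)
    have : Q k i j (N k i j) := Classical.epsilon_spec (p := Q k i j) ⟨n, by rw [hn] at hz; exact hz⟩
    exact hz.unique this
  have key : ∀ i j k l, i < j → k < l → i < k → j ≠ k → j ≠ l →
      ε j k + ε k i + ε l j + ε i l + 2 * (N k i j + N j k l - N l i j - N i k l) = 0 := by
    intro i j k l hij hkl hik hjk hjl
    have hil : i ≠ l := (hik.trans hkl).ne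
    have D := hd i j k l hij hkl hik hjk hjl
    obtain ⟨z1, z2, z3, z4, g1, g2, g3, g4, hz⟩ :=
      square_chg (e i j) (e k l) (hc _ _ hij) (hc _ _ hkl) D
    have d00 := D 0 0
    have d01 := D 0 1
    have d10 := D 1 0
    have d11 := D 1 1
    rw [h0 _ _ hkl] at g1 d00 d10
    rw [h1 _ _ hkl] at g2 d01 d11
    rw [h0 _ _ hij] at g3 d00 d01
    rw [h1 _ _ hij] at g4 d10 d11
    have e1 := hN _ _ _ _ hij d00 d10 g1
    have e2 := hN _ _ _ _ hij d01 d11 g2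
    have e3 := hN _ _ _ _ hkl d00.symm d01.symm g3
    have e4 := hN _ _ _ _ hkl d10.symm d11.symm g4
    have f1 := hAε j k hjk
    have f2 := hAε k i hik.ne'
    have f3 := hAε l j hjl.symm
    have f4 := hAε i l hil
    have hpi : (Real.pi * Complex.I : ℂ) ≠ 0 := by
      simp [Real.pi_ne_zero]
    have : (Real.pi * Complex.I : ℂ) * (((ε j k + ε k i + ε l j + ε i l +
        2 * (N k i j + N j k l - N l i j - N i k l) : ℤ)) : ℂ) = 0 := by
      push_cast
      linear_combination hz - e1 - e4 + e2 + e3 - f1 - f2 - f3 - f4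
    exact_mod_cast (mul_eq_zero.1 this).resolve_left hpi
  have k1 := key 0 1 2 3 (by decide) (by decide) (by decide) (by decide) (by decide)
  have k2 := key 0 1 2 4 (by decide) (by decide) (by decide) (by decide) (by decide)
  have k3 := key 0 1 3 4 (by decide) (by decide) (by decide) (by decide) (by decide)
  have k4 := key 0 2 1 3 (by decide) (by decide) (by decide) (by decide) (by decide)
  have k5 := key 0 2 1 4 (by decide) (by decide) (by decide) (by decide) (by decide)
  have k6 := key 0 2 3 4 (by decide) (by decide) (by decide) (by decide) (by decide)
  have k7 := key 0 3 1 2 (by decide) (by decide) (by decide) (by decide) (by decide)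
  have k8 := key 0 3 1 4 (by decide) (by decide) (by decide) (by decide) (by decide)
  have k9 := key 0 3 2 4 (by decide) (by decide) (by decide) (by decide) (by decide)
  have k10 := key 0 4 1 2 (by decide) (by decide) (by decide) (by decide) (by decide)
  have k11 := key 0 4 1 3 (by decide) (by decide) (by decide) (by decide) (by decide)
  have k12 := key 0 4 2 3 (by decide) (by decide) (by decide) (by decide) (by decide)
  have k13 := key 1 2 3 4 (by decide) (by decide) (by decide) (by decide) (by decide)
  have k14 := key 1 3 2 4 (by decide) (by decide) (by decide) (by decide) (by decide)
  have k15 := key 1 4 2 3 (by decide) (by decide) (by decide) (by decide) (by decide)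
  clear_value N
  clear key hN
  simp [hε] at k1 k2 k3 k4 k5 k6 k7 k8 k9 k10 k11 k12 k13 k14 k15
  omega

/-- A path in `S` from `a` to `b`. -/
def Conn (S : Set (ℝ × ℝ)) (a b : ℝ × ℝ) : Prop :=
  ∃ f : ℝ → ℝ × ℝ, Continuous f ∧ f 0 = a ∧ f 1 = b ∧ ∀ x, f x ∈ S

lemma Conn.symm {S : Set (ℝ × ℝ)} {a b : ℝ × ℝ} (h : Conn S a b) : Conn S b a := by
  obtain ⟨f, hf, h0, h1, hS⟩ := h
  exact ⟨fun x => f (1 - x), by fun_prop, by simpa, by simpa, fun x => hS _⟩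

lemma conn_of_continuousOn (f : ℝ → ℝ × ℝ) (hf : ContinuousOn f (Set.Icc 0 1)) :
    Conn (f '' Set.Icc 0 1) (f 0) (f 1) := by
  refine ⟨fun x => f (Set.projIcc 0 1 zero_le_one x), ?_, ?_, ?_, ?_⟩
  · exact hf.comp_continuous (by fun_prop) (fun x => Subtype.coe_prop _)
  · simp
  · simp
  · intro x
    exact ⟨_, Subtype.coe_prop _, rfl⟩

lemma IsArc.conn {S : Set (ℝ × ℝ)} {a b : ℝ × ℝ} (h : IsArc S a b) : Conn S a b := by
  obtain ⟨f, hf, -, rfl, rfl, rfl⟩ := h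
  exact conn_of_continuousOn f hf

lemma conn_image (g : ℝ → ℝ × ℝ) (hg : Continuous g) {a b : ℝ} (hab : a ≤ b) :
    Conn (g '' Set.Icc a b) (g a) (g b) := by
  obtain ⟨f, hf, h0, h1, hS⟩ := conn_of_continuousOn (fun x => g (a + x * (b - a)))
    (by fun_prop)
  refine ⟨f, hf, by simpa using h0, by simpa using h1, fun x => ?_⟩
  obtain ⟨y, hy, hxy⟩ := hS x
  refine ⟨_, ?_, hxy⟩
  constructor
  · nlinarith [hy.1]
  · nlinarith [hy.2]

lemma k5_plane (p : Fin 5 → ℝ × ℝ) (S : Fin 5 → Fin 5 → Set (ℝ × ℝ))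
    (hc : ∀ i j, i < j → Conn (S i j) (p i) (p j))
    (hd : ∀ i j k l, i < j → k < l → i < k → j ≠ k → j ≠ l → Disjoint (S i j) (S k l)) :
    False := by
  have hc' : ∀ i j, ∃ f : ℝ → ℝ × ℝ, i < j →
      (Continuous f ∧ f 0 = p i ∧ f 1 = p j ∧ ∀ x, f x ∈ S i j) := by
    intro i j
    by_cases h : i < j
    · obtain ⟨f, hf⟩ := hc i j h
      exact ⟨f, fun _ => hf⟩
    · exact ⟨fun _ => 0, fun h' => absurd h' h⟩
  choose f hf using hc'
  refine k5_core (fun i => Complex.equivRealProdCLM.symm (p i))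
    (fun i j x => Complex.equivRealProdCLM.symm (f i j x)) ?_ ?_ ?_ ?_
  · intro i j hij
    exact Complex.equivRealProdCLM.symm.continuous.comp (hf i j hij).1
  · intro i j hij
    simp only [(hf i j hij).2.1]
  · intro i j hij
    simp only [(hf i j hij).2.2.1]
  · intro i j k l hij hkl hik hjk hjl x y h
    have h' := Complex.equivRealProdCLM.symm.injective h
    exact Set.disjoint_left.1 (hd i j k l hij hkl hik hjk hjl) ((hf i j hij).2.2.2 x)
      (h' ▸ (hf k l hkl).2.2.2 y)

lemma split_curve_aux (P : Set (ℝ × ℝ)) (g : ℝ → ℝ × ℝ) (hg : Continuous g) (hgP : ∀ x, g x ∈ P)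
    (h01 : g 1 = g 0) (hinj : Set.InjOn g (Set.Ico 0 1)) {μ τ ν : ℝ} (h1 : 0 < μ) (h2 : μ < τ)
    (h3 : τ < ν) (h4 : ν < 1) :
    ∃ A B C D : Set (ℝ × ℝ), A ⊆ P ∧ B ⊆ P ∧ C ⊆ P ∧ D ⊆ P ∧
      Conn A (g 0) (g μ) ∧ Conn B (g μ) (g τ) ∧ Conn C (g τ) (g ν) ∧ Conn D (g 0) (g ν) ∧
      Disjoint A C ∧ Disjoint B D ∧ g 0 ∉ B ∧ g 0 ∉ C ∧ g μ ∉ C ∧ g μ ∉ D ∧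
      g τ ∉ A ∧ g τ ∉ D ∧ g ν ∉ A ∧ g ν ∉ B := by
  have hsub : ∀ a b, g '' Set.Icc a b ⊆ P := by
    rintro a b _ ⟨x, -, rfl⟩; exact hgP x
  have hAC : Disjoint (g '' Set.Icc 0 μ) (g '' Set.Icc τ ν) := by
    rw [Set.disjoint_left]
    rintro _ ⟨x, hx, rfl⟩ ⟨y, hy, hxy⟩
    have := hinj ⟨by linarith [hy.1], by linarith [hy.2]⟩ ⟨hx.1, by linarith [hx.2]⟩ hxy
    linarith [hx.2, hy.1]
  have hBD : Disjoint (g '' Set.Icc μ τ) (g '' Set.Icc ν 1) := by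
    rw [Set.disjoint_left]
    rintro _ ⟨x, hx, rfl⟩ ⟨y, hy, hxy⟩
    rcases hy.2.lt_or_eq with h | h
    · have := hinj ⟨by linarith [hy.1], h⟩ ⟨by linarith [hx.1], by linarith [hx.2]⟩ hxy
      linarith [hx.2, hy.1]
    · rw [h, h01] at hxy
      have := hinj ⟨le_rfl, one_pos⟩ ⟨by linarith [hx.1], by linarith [hx.2]⟩ hxy
      linarith [hx.1]
  have m0 : g 0 ∈ g '' Set.Icc 0 μ := ⟨0, ⟨le_rfl, h1.le⟩, rfl⟩
  have m1 : g μ ∈ g '' Set.Icc 0 μ := ⟨μ, ⟨h1.le, le_rfl⟩, rfl⟩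
  have m2 : g μ ∈ g '' Set.Icc μ τ := ⟨μ, ⟨le_rfl, h2.le⟩, rfl⟩
  have m3 : g τ ∈ g '' Set.Icc μ τ := ⟨τ, ⟨h2.le, le_rfl⟩, rfl⟩
  have m4 : g τ ∈ g '' Set.Icc τ ν := ⟨τ, ⟨le_rfl, h3.le⟩, rfl⟩
  have m5 : g ν ∈ g '' Set.Icc τ ν := ⟨ν, ⟨h3.le, le_rfl⟩, rfl⟩
  have m6 : g ν ∈ g '' Set.Icc ν 1 := ⟨ν, ⟨le_rfl, h4.le⟩, rfl⟩
  have m7 : g 0 ∈ g '' Set.Icc ν 1 := ⟨1, ⟨h4.le, le_rfl⟩, h01⟩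
  refine ⟨g '' Set.Icc 0 μ, g '' Set.Icc μ τ, g '' Set.Icc τ ν, g '' Set.Icc ν 1,
    hsub _ _, hsub _ _, hsub _ _, hsub _ _, conn_image g hg h1.le, conn_image g hg h2.le,
    conn_image g hg h3.le, h01 ▸ (conn_image g hg h4.le).symm, hAC, hBD,
    Set.disjoint_right.1 hBD m7, Set.disjoint_left.1 hAC m0, Set.disjoint_left.1 hAC m1,
    Set.disjoint_left.1 hBD m2, Set.disjoint_right.1 hAC m4, Set.disjoint_left.1 hBD m3,
    Set.disjoint_right.1 hAC m5, Set.disjoint_right.1 hBD m6⟩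

lemma split_curve (P : Set (ℝ × ℝ)) (hP : IsSimpleClosedCurve P)
    (s u t v : ℝ × ℝ) (hcyc : Interleaved P s u t v) :
    ∃ A B C D : Set (ℝ × ℝ), A ⊆ P ∧ B ⊆ P ∧ C ⊆ P ∧ D ⊆ P ∧
      Conn A s u ∧ Conn B u t ∧ Conn C t v ∧ Conn D s v ∧
      Disjoint A C ∧ Disjoint B D ∧ s ∉ B ∧ s ∉ C ∧ u ∉ C ∧ u ∉ D ∧
      t ∉ A ∧ t ∉ D ∧ v ∉ A ∧ v ∉ B := by
  obtain ⟨f, hf, hfi, rfl⟩ := hP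
  obtain ⟨⟨xs, rfl⟩, hu, ht, hv, hnd, hcc⟩ := hcyc
  set g : ℝ → ℝ × ℝ := fun r => f (xs + (r : AddCircle (1 : ℝ))) with hgdef
  have hg : Continuous g := hf.comp (continuous_const.add (AddCircle.continuous_mk' 1))
  have hg0 : g 0 = f xs := by simp [hgdef]
  have h01 : g 1 = g 0 := by
    have : ((1 : ℝ) : AddCircle (1 : ℝ)) = 0 := AddCircle.coe_period 1
    simp [hgdef, this]
  haveI : Fact ((0 : ℝ) < 1) := ⟨one_pos⟩
  have hinj : Set.InjOn g (Set.Ico 0 1) := by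
    intro x hx y hy hxy
    have h := add_left_cancel (hfi hxy)
    exact (AddCircle.coe_eq_coe_iff_of_mem_Ico (p := (1 : ℝ)) (a := 0) (by simpa using hx)
      (by simpa using hy)).1 h
  have hsurj : ∀ y ∈ Set.range f, ∃ r ∈ Set.Ico (0 : ℝ) 1, g r = y := by
    rintro _ ⟨x, rfl⟩
    have : x - xs ∈ ((↑) : ℝ → AddCircle (1 : ℝ)) '' Set.Ico 0 (0 + 1) := by
      rw [AddCircle.coe_image_Ico_eq]; trivial
    obtain ⟨r, hr, hrx⟩ := this
    exact ⟨r, by simpa using hr, by simp [hgdef, hrx]⟩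
  have hgP : ∀ x, g x ∈ Set.range f := fun x => ⟨_, rfl⟩
  rw [← hg0] at hnd hcc ⊢
  clear_value g
  obtain ⟨τ, hτ, rfl⟩ := hsurj t ht
  obtain ⟨μ, hμ, rfl⟩ := hsurj u hu
  obtain ⟨ν, hν, rfl⟩ := hsurj v hv
  simp only [List.nodup_cons, List.mem_cons, List.not_mem_nil, or_false, not_or] at hnd
  obtain ⟨⟨nsu, nst, nsv⟩, ⟨nut, nuv⟩, ntv, -⟩ := hnd
  have pos : ∀ x ∈ Set.Ico (0 : ℝ) 1, g 0 ≠ g x → 0 < x := by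
    intro x hx hne
    rcases hx.1.lt_or_eq with h | h
    · exact h
    · exact absurd (by rw [h]) hne
  have τ0 := pos _ hτ nst
  have μ0 := pos _ hμ nsu
  have ν0 := pos _ hν nsv
  have neμτ : μ ≠ τ := fun h => nut (by rw [h])
  have neντ : ν ≠ τ := fun h => ntv (by rw [h])
  have comp : ∀ a b : ℝ, (∀ x ∈ Set.Ioo a b, 0 < x ∧ x < 1 ∧ x ≠ τ) → μ ∈ Set.Ioo a b →
      ν ∈ Set.Ioo a b → False := by
    intro a b hab hm hn
    apply hcc
    have hpre : IsPreconnected (g '' Set.Ioo a b) := isPreconnected_Ioo.image g hg.continuousOn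
    have hsub : g '' Set.Ioo a b ⊆ Set.range f \ {g 0, g τ} := by
      rintro _ ⟨x, hx, rfl⟩
      obtain ⟨q1, q2, q3⟩ := hab x hx
      refine ⟨hgP x, ?_⟩
      rintro (h | h)
      · exact q1.ne' (hinj ⟨q1.le, q2⟩ ⟨le_rfl, one_pos⟩ h)
      · exact q3 (hinj ⟨q1.le, q2⟩ hτ h)
    exact connectedComponentIn_eq
      (hpre.subset_connectedComponentIn ⟨μ, hm, rfl⟩ hsub ⟨ν, hn, rfl⟩)
  rcases lt_or_gt_of_ne neμτ with h1 | h1 <;> rcases lt_or_gt_of_ne neντ with h2 | h2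
  · exact (comp 0 τ (fun x hx => ⟨hx.1, hx.2.trans hτ.2, hx.2.ne⟩) ⟨μ0, h1⟩ ⟨ν0, h2⟩).elim
  · exact split_curve_aux _ g hg hgP h01 hinj μ0 h1 h2 hν.2
  · obtain ⟨A, B, C, D, a1, a2, a3, a4, c1, c2, c3, c4, d1, d2, e1, e2, e3, e4, e5, e6, e7, e8⟩ :=
      split_curve_aux _ g hg hgP h01 hinj ν0 h2 h1 hμ.2
    exact ⟨D, C, B, A, a4, a3, a2, a1, c4, c3.symm, c2.symm, c1, d2.symm, d1.symm, e2, e1, e8, e7,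
      e6, e5, e4, e3⟩
  · exact (comp τ 1 (fun x hx => ⟨τ0.trans hx.1, hx.2, hx.1.ne'⟩) ⟨h1, hμ.2⟩ ⟨h2, hν.2⟩).elim

/-- A spoke avoids every part of `P` not containing its end. -/
lemma spoke_disj {P γ A : Set (ℝ × ℝ)} {s : ℝ × ℝ} (h : γ ∩ P = {s}) (hA : A ⊆ P) (hs : s ∉ A) :
    Disjoint γ A := by
  rw [Set.disjoint_left]
  intro x hx hxA
  have : x ∈ γ ∩ P := ⟨hx, hA hxA⟩
  rw [h] at this
  exact hs (this ▸ hxA)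

/-- A spoke avoids every exterior arc not containing its end. -/
lemma spoke_ext_disj {P γ α : Set (ℝ × ℝ)} {s a b : ℝ × ℝ} (h : γ ∩ P = {s})
    (hi : γ \ {s} ⊆ JordanInterior P) (hα : α ∩ P = {a, b})
    (he : α \ {a, b} ⊆ JordanExterior P) (ha : s ≠ a) (hb : s ≠ b) : Disjoint γ α := by
  rw [Set.disjoint_left]
  intro x hx hxα
  by_cases hxP : x ∈ P
  · have h1 : x ∈ γ ∩ P := ⟨hx, hxP⟩
    have h2 : x ∈ α ∩ P := ⟨hxα, hxP⟩
    rw [h] at h1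
    rw [hα] at h2
    rw [Set.mem_singleton_iff] at h1
    subst h1
    rcases h2 with h2 | h2
    · exact ha h2
    · exact hb h2
  · have h1 : x ∈ JordanInterior P := hi ⟨hx, fun h' => hxP (by
      have : x ∈ γ ∩ P := by rw [h]; exact h'
      exact this.2)⟩
    have h2 : x ∈ JordanExterior P := he ⟨hxα, fun h' => hxP (by
      have : x ∈ α ∩ P := by rw [hα]; exact h'
      exact this.2)⟩
    exact h2.2 h1.2

/-- Adding a hub: if `s, u, t, v` lie in interleaved cyclic order on a simple closed
curve `P`, there exist disjoint simple exterior arcs joining `s` to `t` and `u` to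
`v`, and an interior point `w` is joined to `s, t, u, v` by four interior arcs that
are pairwise disjoint except at `w`, then the resulting configuration is a plane
embedding of (a subdivision of) K₅ — which is impossible; hence `False`. -/
theorem no_hub_configuration (P : Set (ℝ × ℝ)) (hP : IsSimpleClosedCurve P)
    (s u t v : ℝ × ℝ) (hcyc : Interleaved P s u t v)
    (α β : Set (ℝ × ℝ)) (hα : IsArc α s t) (hβ : IsArc β u v)
    (hαP : α ∩ P = {s, t}) (hβP : β ∩ P = {u, v})
    (hαext : α \ {s, t} ⊆ JordanExterior P) (hβext : β \ {u, v} ⊆ JordanExterior P)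
    (hαβ : α ∩ β = ∅)
    (w : ℝ × ℝ) (hw : w ∈ JordanInterior P)
    (γs γt γu γv : Set (ℝ × ℝ))
    (hγs : IsArc γs w s) (hγt : IsArc γt w t) (hγu : IsArc γu w u)
    (hγv : IsArc γv w v)
    (hγsP : γs ∩ P = {s}) (hγtP : γt ∩ P = {t}) (hγuP : γu ∩ P = {u})
    (hγvP : γv ∩ P = {v})
    (hγsint : γs \ {s} ⊆ JordanInterior P) (hγtint : γt \ {t} ⊆ JordanInterior P)
    (hγuint : γu \ {u} ⊆ JordanInterior P) (hγvint : γv \ {v} ⊆ JordanInterior P)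
    (hst : γs ∩ γt = {w}) (hsu : γs ∩ γu = {w}) (hsv : γs ∩ γv = {w})
    (htu : γt ∩ γu = {w}) (htv : γt ∩ γv = {w}) (huv : γu ∩ γv = {w}) :
    False := by
  obtain ⟨A, B, C, D, a1, a2, a3, a4, c1, c2, c3, c4, d1, d2, e1, e2, e3, e4, e5, e6, e7, e8⟩ :=
    split_curve P hP s u t v hcyc
  obtain ⟨-, -, -, -, hnd, -⟩ := hcyc
  simp only [List.nodup_cons, List.mem_cons, List.not_mem_nil, or_false, not_or] at hnd
  obtain ⟨⟨nsu, nst, nsv⟩, ⟨nut, nuv⟩, ntv, -⟩ := hnd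
  have x1 : Disjoint γs B := spoke_disj hγsP a2 e1
  have x2 : Disjoint γs C := spoke_disj hγsP a3 e2
  have x3 : Disjoint γu C := spoke_disj hγuP a3 e3
  have x4 : Disjoint γu D := spoke_disj hγuP a4 e4
  have x5 : Disjoint γt A := spoke_disj hγtP a1 e5
  have x6 : Disjoint γt D := spoke_disj hγtP a4 e6
  have x7 : Disjoint γv A := spoke_disj hγvP a1 e7
  have x8 : Disjoint γv B := spoke_disj hγvP a2 e8
  have y1 : Disjoint γs β := spoke_ext_disj hγsP hγsint hβP hβext nsu nsv
  have y2 : Disjoint γt β := spoke_ext_disj hγtP hγtint hβP hβext (Ne.symm nut) ntv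
  have y3 : Disjoint γu α := spoke_ext_disj hγuP hγuint hαP hαext (Ne.symm nsu) nut
  have y4 : Disjoint γv α := spoke_ext_disj hγvP hγvint hαP hαext (Ne.symm nsv) (Ne.symm ntv)
  have hαβ' : Disjoint α β := Set.disjoint_iff_inter_eq_empty.2 hαβ
  refine k5_plane ![w, s, u, t, v]
    ![![∅, γs, γu, γt, γv], ![∅, ∅, A, α, D], ![∅, ∅, ∅, B, β], ![∅, ∅, ∅, ∅, C],
      ![∅, ∅, ∅, ∅, ∅]] ?_ ?_
  · have := hα.conn
    have := hβ.conn
    have := hγs.conn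
    have := hγt.conn
    have := hγu.conn
    have := hγv.conn
    intro i j hij
    fin_cases i <;> fin_cases j <;> first | (exact absurd hij (by decide)) | assumption
  · intro i j k l hij hkl hik hjk hjl
    have := d2.symm
    fin_cases i <;> fin_cases j <;> first
      | (exact absurd hij (by decide))
      | (fin_cases k <;> first
        | (exact absurd hik (by decide))
        | (exact absurd rfl hjk)
        | (fin_cases l <;> first
          | (exact absurd hkl (by decide))
          | (exact absurd rfl hjl)
          | assumption))
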